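/- The restrictive probabilistic symmetric opacity is a probability: 0 ≤ RPSO(μ,φ,𝒪) ≤ 1. (Proposition 3, item 1 of the paper.) -/

import Mathlib

open scoped ENNReal Classical

/-- The probability of a set of runs under a PMF. -/
noncomputable def mOf {R : Type*} (μ : PMF R) (S : Set R) : ℝ≥0∞ :=
  ∑' ρ : S, μ ρ

/-- Liberal probabilistic opacity. -/
noncomputable def LPO {R Obs : Type*} (μ : PMF R) (φ : Set R) (O : R → Obs) : ℝ≥0∞ :=
  ∑' o : Obs, if O ⁻¹' {o} ⊆ φ then mOf μ (O ⁻¹' {o}) else 0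

/-- Liberal probabilistic symmetrical opacity. -/
noncomputable def LPSO {R Obs : Type*} (μ : PMF R) (φ : Set R) (O : R → Obs) : ℝ≥0∞ :=
  LPO μ φ O + LPO μ φᶜ O

/-- Restrictive probabilistic opacity. -/
noncomputable def RPO {R Obs : Type*} (μ : PMF R) (φ : Set R) (O : R → Obs) : ℝ≥0∞ :=
  (∑' o : Obs, (mOf μ (O ⁻¹' {o})) ^ 2 / mOf μ (φᶜ ∩ O ⁻¹' {o}))⁻¹

/-- Vulnerability of φ within the observation class of o. -/
noncomputable def Vul {R Obs : Type*} (μ : PMF R) (φ : Set R) (O : R → Obs) (o : Obs) : ℝ≥0∞ :=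
  max (mOf μ (φ ∩ O ⁻¹' {o})) (mOf μ (φᶜ ∩ O ⁻¹' {o})) / mOf μ (O ⁻¹' {o})

/-- Restrictive probabilistic symmetric opacity. -/
noncomputable def RPSO {R Obs : Type*} (μ : PMF R) (φ : Set R) (O : R → Obs) : ℝ≥0∞ :=
  (∑' o : Obs, mOf μ (O ⁻¹' {o}) *
    (if Vul μ φ O o = 1 then ⊤
     else ENNReal.ofReal (- Real.logb 2 ((1 - Vul μ φ O o).toReal))))⁻¹

/-- φ is opaque for the observation O. -/
def IsOpaque {R Obs : Type*} (φ : Set R) (O : R → Obs) : Prop :=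
  ∀ o : Obs, ¬ O ⁻¹' {o} ⊆ φ

/-- φ is symmetrically opaque for the observation O. -/
def IsSymOpaque {R Obs : Type*} (φ : Set R) (O : R → Obs) : Prop :=
  ∀ o : Obs, ¬ O ⁻¹' {o} ⊆ φ ∧ ¬ O ⁻¹' {o} ⊆ φᶜ

theorem tsum_mOf_fiber {R Obs : Type*} (μ : PMF R) (O : R → Obs) :
    ∑' o : Obs, mOf μ (O ⁻¹' {o}) = 1 := by
  unfold mOf
  rw [ENNReal.tsum_fiberwise, μ.tsum_coe]

theorem mOf_inter_add_compl_inter {R : Type*} (μ : PMF R) (φ S : Set R) :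
    mOf μ (φ ∩ S) + mOf μ (φᶜ ∩ S) = mOf μ S := by
  simp only [mOf, tsum_subtype, ← ENNReal.tsum_add]
  refine tsum_congr fun ρ => ?_
  by_cases h : ρ ∈ φ <;> by_cases h' : ρ ∈ S <;> simp [h, h']

theorem mOf_le_one {R : Type*} (μ : PMF R) (S : Set R) : mOf μ S ≤ 1 :=
  (ENNReal.tsum_comp_le_tsum_of_injective Subtype.val_injective μ).trans μ.tsum_coe.le

theorem mOf_ne_zero {R : Type*} {μ : PMF R} {S : Set R} {ρ : R} (hρ : ρ ∈ S)
    (h : μ ρ ≠ 0) : mOf μ S ≠ 0 :=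
  fun h0 => h (ENNReal.tsum_eq_zero.1 h0 ⟨ρ, hρ⟩)

theorem Vul_le_one {R Obs : Type*} (μ : PMF R) (φ : Set R) (O : R → Obs) (o : Obs) :
    Vul μ φ O o ≤ 1 := by
  refine ENNReal.div_le_of_le_mul ?_
  rw [one_mul, ← mOf_inter_add_compl_inter μ φ (O ⁻¹' {o})]
  exact max_le le_self_add le_add_self

theorem half_le_Vul {R Obs : Type*} (μ : PMF R) (φ : Set R) (O : R → Obs) (o : Obs)
    (h : mOf μ (O ⁻¹' {o}) ≠ 0) : 2⁻¹ ≤ Vul μ φ O o := by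
  have htop : mOf μ (O ⁻¹' {o}) ≠ ⊤ := ne_top_of_le_ne_top ENNReal.one_ne_top (mOf_le_one _ _)
  rw [Vul, ENNReal.le_div_iff_mul_le (Or.inl h) (Or.inl htop), mul_comm, ← div_eq_mul_inv]
  refine ENNReal.div_le_of_le_mul ?_
  rw [← mOf_inter_add_compl_inter μ φ (O ⁻¹' {o}), mul_two]
  exact add_le_add (le_max_left _ _) (le_max_right _ _)

/-- The binary logarithmic penalty of a value in `[1/2, 1)` is at least one. -/
theorem one_le_ofReal_neg_logb_one_sub {v : ℝ≥0∞} (h : 2⁻¹ ≤ v) (hv : v < 1) :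
    1 ≤ ENNReal.ofReal (-Real.logb 2 (1 - v).toReal) := by
  have hpos : 0 < (1 - v).toReal :=
    ENNReal.toReal_pos (tsub_pos_of_lt hv).ne' (ENNReal.sub_ne_top ENNReal.one_ne_top)
  have hle : (1 - v).toReal ≤ 2⁻¹ := by
    have : 1 - v ≤ 2⁻¹ := by
      simpa only [ENNReal.one_sub_inv_two] using tsub_le_tsub_left h 1
    simpa using ENNReal.toReal_mono (by simp) this
  have hlog : Real.logb 2 (1 - v).toReal ≤ -1 := by
    rw [Real.logb_le_iff_le_rpow one_lt_two hpos, Real.rpow_neg_one]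
    exact hle
  rw [ENNReal.one_le_ofReal]
  linarith

/-- Proposition 3, item 1: restrictive probabilistic symmetric opacity is a probability. -/
theorem rpso_is_probability {R Obs : Type*} [Countable R]
    (μ : PMF R) (φ : Set R) (O : R → Obs)
    (hsupp : ∀ ρ : R, μ ρ ≠ 0) (hsurj : Function.Surjective O) :
    0 ≤ RPSO μ φ O ∧ RPSO μ φ O ≤ 1 := by
  refine ⟨zero_le, ENNReal.inv_le_one.2 ?_⟩
  refine (tsum_mOf_fiber μ O).ge.trans
    (ENNReal.tsum_le_tsum fun o => le_mul_of_one_le_right zero_le ?_)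
  obtain ⟨ρ, hρ⟩ := hsurj o
  have hhalf := half_le_Vul μ φ O o (mOf_ne_zero (S := O ⁻¹' {o}) hρ (hsupp ρ))
  split_ifs with hV
  · exact le_top
  · exact one_le_ofReal_neg_logb_one_sub hhalf ((Vul_le_one μ φ O o).lt_of_ne hV)
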